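/- Let C be a finite set of clusters, w : C → ℝ nonnegative with total weight W = Σ_c w(c) > 0, θ : C → C → ℝ nonnegative and symmetric, and k ≥ 1. Define F̄(c) = Σ_{c' ≠ c} θ(c, c'), T = Σ_{c ∈ C} (F̄(c) + w(c)), and set δ = k·T/W². Then for any two assignments f, g : C → Fin k, the social welfares satisfy S(f) ≤ (k+1)·S(g). In particular, the Price of Anarchy of the Stackelberg game, i.e. the maximum over pure Nash equilibria Λ* of S(Λ*)/OPT where OPT is the minimum of S over all assignments, is bounded by k + 1. -/

import Mathlib

/-- Load of partition `p`: total weight of clusters assigned to `p`. -/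
noncomputable def load {C : Type*} [Fintype C] {k : ℕ} (w : C → ℝ) (f : C → Fin k)
    (p : Fin k) : ℝ :=
  ∑ c ∈ Finset.univ.filter (fun c => f c = p), w c

/-- `F(c)`: total inter-cluster edge count of `c` towards clusters in other partitions. -/
noncomputable def Fcost {C : Type*} [Fintype C] {k : ℕ} (θ : C → C → ℝ) (f : C → Fin k)
    (c : C) : ℝ :=
  ∑ c', θ c c' * (if f c ≠ f c' then 1 else 0)

/-- `cut(p)`: sum of `F(c)` over clusters `c` assigned to partition `p`. -/
noncomputable def cut {C : Type*} [Fintype C] {k : ℕ} (θ : C → C → ℝ) (w : C → ℝ)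
    (f : C → Fin k) (p : Fin k) : ℝ :=
  ∑ c ∈ Finset.univ.filter (fun c => f c = p), Fcost θ f c

/-- Social welfare of the assignment `f` with normalization `δ = k·T/W²`. -/
noncomputable def socialWelfare {C : Type*} [Fintype C] [DecidableEq C]
    (w : C → ℝ) (θ : C → C → ℝ) (k : ℕ) (f : C → Fin k) : ℝ :=
  ((k : ℝ) * (∑ c, ((∑ c' ∈ Finset.univ.erase c, θ c c') + w c)) / (∑ c, w c) ^ 2 / k)
    * ∑ p : Fin k, (load w f p) ^ 2
  + (1 / k) * ∑ p : Fin k, (cut θ w f p + load w f p)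

theorem sum_load {C : Type*} [Fintype C] {k : ℕ} (w : C → ℝ) (f : C → Fin k) :
    ∑ p, load w f p = ∑ c, w c :=
  Finset.sum_fiberwise _ _ _

theorem sum_cut {C : Type*} [Fintype C] {k : ℕ} (θ : C → C → ℝ) (w : C → ℝ) (f : C → Fin k) :
    ∑ p, cut θ w f p = ∑ c, Fcost θ f c :=
  Finset.sum_fiberwise _ _ _

theorem load_nonneg {C : Type*} [Fintype C] {k : ℕ} {w : C → ℝ} (hw : ∀ c, 0 ≤ w c)
    (f : C → Fin k) (p : Fin k) : 0 ≤ load w f p :=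
  Finset.sum_nonneg fun c _ => hw c

theorem Fcost_nonneg {C : Type*} [Fintype C] {k : ℕ} {θ : C → C → ℝ}
    (hθ : ∀ c c', 0 ≤ θ c c') (f : C → Fin k) (c : C) : 0 ≤ Fcost θ f c :=
  Finset.sum_nonneg fun c' _ => mul_nonneg (hθ c c') (by split_ifs <;> norm_num)

theorem Fcost_le_sum_erase {C : Type*} [Fintype C] [DecidableEq C] {k : ℕ} {θ : C → C → ℝ}
    (hθ : ∀ c c', 0 ≤ θ c c') (f : C → Fin k) (c : C) :
    Fcost θ f c ≤ ∑ c' ∈ Finset.univ.erase c, θ c c' := by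
  unfold Fcost
  rw [← Finset.sum_erase Finset.univ (a := c) (by simp)]
  refine Finset.sum_le_sum fun c' _ => mul_le_of_le_one_right (hθ c c') ?_
  split_ifs <;> norm_num

theorem sum_sq_load_le {C : Type*} [Fintype C] {k : ℕ} {w : C → ℝ} (hw : ∀ c, 0 ≤ w c)
    (f : C → Fin k) : ∑ p, load w f p ^ 2 ≤ (∑ c, w c) ^ 2 := by
  rw [← sum_load w f]
  exact Finset.sum_sq_le_sq_sum_of_nonneg fun p _ => load_nonneg hw f p

theorem sq_sum_le_mul_sum_sq_load {C : Type*} [Fintype C] {k : ℕ} (w : C → ℝ)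
    (f : C → Fin k) : (∑ c, w c) ^ 2 ≤ k * ∑ p, load w f p ^ 2 := by
  rw [← sum_load w f]
  simpa using sq_sum_le_card_mul_sum_sq (s := Finset.univ) (f := load w f)

/-- Price of Anarchy bound: for any two assignments `f` and `g`,
`S(f) ≤ (k+1)·S(g)`; in particular the PoA of the Stackelberg game is at most `k+1`. -/
theorem price_of_anarchy_bound {C : Type*} [Fintype C] [DecidableEq C]
    (w : C → ℝ) (hw : ∀ c, 0 ≤ w c) (hW : 0 < ∑ c, w c)
    (θ : C → C → ℝ) (hθ : ∀ c c', 0 ≤ θ c c') (hsym : ∀ c c', θ c c' = θ c' c)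
    (k : ℕ) (hk : 1 ≤ k) (f g : C → Fin k) :
    socialWelfare w θ k f ≤ ((k : ℝ) + 1) * socialWelfare w θ k g := by
  have hk0 : (0 : ℝ) < k := by exact_mod_cast hk
  unfold socialWelfare
  simp only [Finset.sum_add_distrib, sum_load, sum_cut]
  have hcut := Finset.sum_le_sum fun c (_ : c ∈ Finset.univ) => Fcost_le_sum_erase hθ f c
  have hcut_f := Finset.sum_nonneg fun c (_ : c ∈ Finset.univ) => Fcost_nonneg hθ f c
  have hcut_g := Finset.sum_nonneg fun c (_ : c ∈ Finset.univ) => Fcost_nonneg hθ g c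
  have hf := sum_sq_load_le hw f
  have hg := sq_sum_le_mul_sum_sq_load w g
  set W := ∑ c, w c
  set E := ∑ c, ∑ c' ∈ Finset.univ.erase c, θ c c'
  have hT : 0 ≤ E + W := by linarith
  have hδ : (k : ℝ) * (E + W) / W ^ 2 / k = (E + W) / W ^ 2 := by field_simp
  have hr : 0 ≤ (E + W) / W ^ 2 := by positivity
  have hrW : (E + W) / W ^ 2 * W ^ 2 = E + W := by field_simp
  rw [hδ]
  calc
    _ ≤ (E + W) / W ^ 2 * W ^ 2 + 1 / k * (E + W) := by gcongr
    _ = ((k : ℝ) + 1) * ((E + W) / W ^ 2 * (W ^ 2 / k)) := by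
      field_simp
    _ ≤ ((k : ℝ) + 1) * ((E + W) / W ^ 2 * ∑ p, load w g p ^ 2) := by
      gcongr
      rw [div_le_iff₀ hk0]
      linarith
    _ ≤ _ := by
      gcongr
      exact le_add_of_nonneg_right (by positivity)
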